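/- arXiv:1502.03579 — 8 statements merged into one kernel-verified Lean document; each statement's English description precedes it below -/
import Mathlib

section
/- Let Γ be a G-prebrick and define its border basis B(Γ) := { e_i + m : i ∈ {1,2,3}, m ∈ Γ } \ Γ. Then the additive submonoid S(Γ) of M is generated, as a monoid, by the finite set { b − wt_Γ(b) : b ∈ B(Γ) }; in particular S(Γ) is a finitely generated monoid. -/
noncomputable section

open Classical

/-- The lattice `ℤ³` of exponents of Laurent monomials in `x, y, z` (written additively). -/
abbrev V3 : Type := Fin 3 → ℤ

/-- The standard basis vectors `e₁, e₂, e₃` (indices `0, 1, 2`). -/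
def ee (i : Fin 3) : V3 := Pi.single i 1

/-- `n` is a genuine monomial, i.e. `n ∈ ℕ³ ⊆ ℤ³`. -/
def IsNat3 (n : V3) : Prop := ∀ i, 0 ≤ n i

/-- The weight map `w(m) = β₁m₁ + β₂m₂ + β₃m₃ (mod s)`. -/
def wmap (s : ℕ) (β : Fin 3 → ℤ) (m : V3) : ZMod s := ((∑ i, β i * m i : ℤ) : ZMod s)

/-- One step of a (fractional) monomial path inside `Γ`: multiply or divide
by one of `x, y, z`, staying in `Γ`. -/
def StepRel (Γ : Set V3) (m m' : V3) : Prop :=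
  m' ∈ Γ ∧ ∃ i : Fin 3, m' = m + ee i ∨ m' = m - ee i

/-- A prebrick with respect to the modulus `s` and the weights `β`. -/
structure IsPrebrick (s : ℕ) (β : Fin 3 → ℤ) (Γ : Set V3) : Prop where
  zero_mem : (0 : V3) ∈ Γ
  bijOn : Set.BijOn (wmap s β) Γ Set.univ
  saturated : ∀ m ∈ Γ, ∀ n n' : V3, IsNat3 n → IsNat3 n' → n' + n + m ∈ Γ → n + m ∈ Γ
  connected : ∀ m ∈ Γ, Relation.ReflTransGen (StepRel Γ) m 0

/-- `wtG s β Γ m` is the unique element of `Γ` with the same weight as `m`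
(when `Γ` is a prebrick). -/
noncomputable def wtG (s : ℕ) (β : Fin 3 → ℤ) (Γ : Set V3) (m : V3) : V3 :=
  Classical.epsilon fun g => g ∈ Γ ∧ wmap s β g = wmap s β m

/-- The monoid `S(Γ)`, generated by all `n + m − wt_Γ(n + m)`, `n ∈ ℕ³`, `m ∈ Γ`. -/
def SG (s : ℕ) (β : Fin 3 → ℤ) (Γ : Set V3) : AddSubmonoid V3 :=
  AddSubmonoid.closure
    {v | ∃ n m : V3, IsNat3 n ∧ m ∈ Γ ∧ v = n + m - wtG s β Γ (n + m)}

/-- A brick: a prebrick with `S(Γ) ∩ (−S(Γ)) = {0}`. -/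
def IsBrick (s : ℕ) (β : Fin 3 → ℤ) (Γ : Set V3) : Prop :=
  IsPrebrick s β Γ ∧ ∀ v ∈ SG s β Γ, -v ∈ SG s β Γ → v = 0

/-- `d(m) = m₁ + a·m₂ + (r−a)·m₃`. -/
def dd (r a : ℕ) (m : V3) : ℤ := m 0 + (a : ℤ) * m 1 + ((r : ℤ) - (a : ℤ)) * m 2

/-- The round down functions of the weighted blowup with weight `(1, a, r−a)`:
`phiRD r a 0 = φ₁` (central), `phiRD r a 1 = φ₂` (left), `phiRD r a 2 = φ₃` (right);
the `k`-th coordinate is replaced by `⌊d(m)/r⌋`. -/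
def phiRD (r a : ℕ) (k : Fin 3) (m : V3) : V3 :=
  Function.update m k ((dd r a m).fdiv (r : ℤ))

/-- Weights `(1, a, r−a)` of the group `G` of type `(1/r)(1, a, r−a)`. -/
def wtsG (r a : ℕ) : Fin 3 → ℤ := ![1, (a : ℤ), (r : ℤ) - (a : ℤ)]

/-- Moduli of the groups `G₁` (trivial), `G₂` of type `(1/a)(1,−r,r)` and
`G₃` of type `(1/(r−a))(1,r,−r)`. -/
def gkMod (r a : ℕ) : Fin 3 → ℕ := ![1, a, r - a]

/-- Weights of the groups `G₁, G₂, G₃`. -/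
def gkWts (r a : ℕ) : Fin 3 → Fin 3 → ℤ :=
  ![![0, 0, 0], ![1, -(r : ℤ), (r : ℤ)], ![1, (r : ℤ), -(r : ℤ)]]

/-- The border basis `B(Γ) = { e_i + m : i ∈ {1,2,3}, m ∈ Γ } \ Γ`. -/
def BorderB (Γ : Set V3) : Set V3 :=
  {b | (∃ i : Fin 3, ∃ m ∈ Γ, b = ee i + m) ∧ b ∉ Γ}

theorem isNat3_ee (i : Fin 3) : IsNat3 (ee i) := fun j => by
  by_cases hj : j = i
  · subst hj; simp [ee]
  · simp [ee, hj]

theorem IsNat3.induction {P : V3 → Prop} (zero : P 0) (step : ∀ i n, P n → P (ee i + n))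
    {n : V3} (hn : IsNat3 n) : P n := by
  induction hk : (∑ i, n i).toNat using Nat.strong_induction_on generalizing n with
  | _ k ih =>
    by_cases h0 : ∃ i, n i ≠ 0
    · obtain ⟨i, hi⟩ := h0
      have hpos : 0 < n i := lt_of_le_of_ne (hn i) hi.symm
      have hn' : IsNat3 (n - ee i) := fun j => by
        by_cases hj : j = i
        · subst hj; simp [ee]; omega
        · simpa [ee, hj] using hn j
      have hsum : ∑ j, (n - ee i) j = ∑ j, n j - 1 := by
        simp [ee, Finset.sum_sub_distrib]
      have hle : n i ≤ ∑ j, n j :=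
        Finset.single_le_sum (fun j _ => hn j) (Finset.mem_univ i)
      simpa using step i _ (ih _ (by omega) hn' rfl)
    · push Not at h0
      rwa [show n = 0 from funext h0]

theorem wmap_add (s : ℕ) (β : Fin 3 → ℤ) (m n : V3) :
    wmap s β (m + n) = wmap s β m + wmap s β n := by
  simp [wmap, mul_add, Finset.sum_add_distrib]

namespace IsPrebrick

variable {s : ℕ} {β : Fin 3 → ℤ} {Γ : Set V3}

theorem wtG_spec (h : IsPrebrick s β Γ) (m : V3) :
    wtG s β Γ m ∈ Γ ∧ wmap s β (wtG s β Γ m) = wmap s β m :=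
  Classical.epsilon_spec (p := fun g => g ∈ Γ ∧ wmap s β g = wmap s β m)
    (h.bijOn.surjOn (Set.mem_univ (wmap s β m)))

theorem wtG_eq_self (h : IsPrebrick s β Γ) {m : V3} (hm : m ∈ Γ) : wtG s β Γ m = m :=
  h.bijOn.injOn (h.wtG_spec m).1 hm (h.wtG_spec m).2

theorem wtG_add_wtG (h : IsPrebrick s β Γ) (n m : V3) :
    wtG s β Γ (n + wtG s β Γ m) = wtG s β Γ (n + m) := by
  refine h.bijOn.injOn (h.wtG_spec _).1 (h.wtG_spec _).1 ?_
  rw [(h.wtG_spec _).2, (h.wtG_spec _).2, wmap_add, wmap_add, (h.wtG_spec m).2]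

theorem finite (h : IsPrebrick s β Γ) (hs : 0 < s) : Γ.Finite :=
  have : NeZero s := ⟨hs.ne'⟩
  Set.Finite.of_injOn h.bijOn.mapsTo h.bijOn.injOn Set.finite_univ

theorem ee_add_sub_wtG_mem (h : IsPrebrick s β Γ) (i : Fin 3) {m : V3} (hm : m ∈ Γ) :
    ee i + m - wtG s β Γ (ee i + m) ∈
      AddSubmonoid.closure ((fun b => b - wtG s β Γ b) '' BorderB Γ) := by
  by_cases hb : ee i + m ∈ Γ
  · rw [h.wtG_eq_self hb, sub_self]
    exact AddSubmonoid.zero_mem _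
  · exact AddSubmonoid.subset_closure ⟨_, ⟨⟨i, m, hm, rfl⟩, hb⟩, rfl⟩

theorem add_sub_wtG_mem (h : IsPrebrick s β Γ) {n m : V3} (hn : IsNat3 n) (hm : m ∈ Γ) :
    n + m - wtG s β Γ (n + m) ∈
      AddSubmonoid.closure ((fun b => b - wtG s β Γ b) '' BorderB Γ) := by
  refine IsNat3.induction (P := fun n => n + m - wtG s β Γ (n + m) ∈ AddSubmonoid.closure _)
    ?_ (fun i n ih => ?_) hn
  · rw [zero_add, h.wtG_eq_self hm, sub_self]
    exact AddSubmonoid.zero_mem _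
  · have hadd := add_mem (h.ee_add_sub_wtG_mem i (h.wtG_spec (n + m)).1) ih
    rw [h.wtG_add_wtG, ← add_assoc] at hadd
    convert hadd using 1
    abel

end IsPrebrick

theorem BorderB_finite {Γ : Set V3} (hΓ : Γ.Finite) : (BorderB Γ).Finite := by
  refine (Set.finite_iUnion fun i : Fin 3 => hΓ.image (ee i + ·)).subset ?_
  rintro _ ⟨⟨i, m, hm, rfl⟩, -⟩
  exact Set.mem_iUnion.2 ⟨i, m, hm, rfl⟩

/-- Lemma 2.8 of the paper: `S(Γ)` is generated as a monoid by the
finite set `{ b − wt_Γ(b) : b ∈ B(Γ) }`; in particular it is finitely generated. -/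
theorem SG_eq_closure_border (r : ℕ) (hr : 0 < r) (β : Fin 3 → ℤ) (Γ : Set V3)
    (h : IsPrebrick r β Γ) :
    SG r β Γ = AddSubmonoid.closure ((fun b => b - wtG r β Γ b) '' BorderB Γ) ∧
      ((fun b => b - wtG r β Γ b) '' BorderB Γ).Finite ∧ (SG r β Γ).FG := by
  have heq : SG r β Γ =
      AddSubmonoid.closure ((fun b => b - wtG r β Γ b) '' BorderB Γ) := by
    refine le_antisymm (AddSubmonoid.closure_le.2 ?_) (AddSubmonoid.closure_mono ?_)
    · rintro _ ⟨n, m, hn, hm, rfl⟩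
      exact h.add_sub_wtG_mem hn hm
    · rintro _ ⟨_, ⟨⟨i, m, hm, rfl⟩, -⟩, rfl⟩
      exact ⟨ee i, m, isNat3_ee i, hm, rfl⟩
  have hfin := (BorderB_finite (h.finite hr)).image fun b => b - wtG r β Γ b
  exact ⟨heq, hfin, (AddSubmonoid.fg_iff _).2 ⟨_, heq.symm, hfin⟩⟩
end
end

section
/- Let Γ be a G-prebrick and let ev : S(Γ) → ℂ satisfy ev(0) = 1 and ev(s + t) = ev(s)·ev(t) for all s, t ∈ S(Γ) (a monoid homomorphism to (ℂ, ×)). Then on the free ℂ-vector space with basis Γ there exists a unique structure of module over the polynomial ring ℂ[x₁,x₂,x₃] such that for every i ∈ {1,2,3} and every basis element m ∈ Γ, x_i · m = ev(e_i + m − wt_Γ(e_i + m)) · wt_Γ(e_i + m). (This module is the G-constellation C(Γ)_p attached to the point p of U(Γ) = Spec ℂ[S(Γ)] with evaluation map ev; in particular Γ is a ℂ-basis of C(Γ)_p.) -/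
noncomputable section

open Classical

section Prebrick

variable {s : ℕ} {β : Fin 3 → ℤ} {Γ : Set V3}

theorem IsPrebrick.wtG_spec_s2 (h : IsPrebrick s β Γ) (m : V3) :
    wtG s β Γ m ∈ Γ ∧ wmap s β (wtG s β Γ m) = wmap s β m :=
  Classical.epsilon_spec (p := fun g => g ∈ Γ ∧ wmap s β g = wmap s β m)
    (h.bijOn.surjOn (Set.mem_univ _))

theorem IsPrebrick.wtG_mem (h : IsPrebrick s β Γ) (m : V3) : wtG s β Γ m ∈ Γ :=
  (h.wtG_spec_s2 m).1

theorem IsPrebrick.wtG_eq_of_mem (h : IsPrebrick s β Γ) {m : V3} (hm : m ∈ Γ) :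
    wtG s β Γ m = m :=
  h.bijOn.injOn (h.wtG_mem m) hm (h.wtG_spec_s2 m).2

theorem IsPrebrick.wtG_add_wtG_s2 (h : IsPrebrick s β Γ) (n m : V3) :
    wtG s β Γ (n + wtG s β Γ m) = wtG s β Γ (n + m) := by
  apply h.bijOn.injOn (h.wtG_mem _) (h.wtG_mem _)
  simp only [(h.wtG_spec_s2 _).2, wmap_add]

theorem sub_wtG_mem_SG {n m : V3} (hn : IsNat3 n) (hm : m ∈ Γ) :
    n + m - wtG s β Γ (n + m) ∈ SG s β Γ :=
  AddSubmonoid.subset_closure ⟨n, m, hn, hm, rfl⟩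

/-- The integer vector of a natural exponent vector. -/
def natExponent (a : Fin 3 →₀ ℕ) : V3 := fun i => a i

theorem isNat3_natExponent (a : Fin 3 →₀ ℕ) : IsNat3 (natExponent a) :=
  fun i => Int.natCast_nonneg (a i)

theorem natExponent_zero : natExponent 0 = 0 := by
  ext i
  simp [natExponent]

theorem natExponent_add (a b : Fin 3 →₀ ℕ) :
    natExponent (a + b) = natExponent a + natExponent b := by
  ext i
  simp [natExponent]

theorem natExponent_single (i : Fin 3) : natExponent (Finsupp.single i 1) = ee i := by
  ext j
  simp [natExponent, ee, Finsupp.single_apply, Pi.single_apply, eq_comm]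

/-- The operator `m ↦ ev(n + m − wt_Γ(n + m)) · wt_Γ(n + m)` by which a monomial `n` acts on
the free vector space on `Γ`. -/
def monomialAction (h : IsPrebrick s β Γ) (ev : V3 → ℂ) (n : V3) :
    Module.End ℂ (↥Γ →₀ ℂ) :=
  Finsupp.linearCombination ℂ fun m : ↥Γ =>
    ev (n + m - wtG s β Γ (n + m)) • Finsupp.single ⟨wtG s β Γ (n + m), h.wtG_mem _⟩ 1

theorem monomialAction_single (h : IsPrebrick s β Γ) (ev : V3 → ℂ) (n : V3) (m g : ↥Γ)
    (hg : (g : V3) = wtG s β Γ (n + m)) :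
    monomialAction h ev n (Finsupp.single m 1) =
      ev (n + m - wtG s β Γ (n + m)) • Finsupp.single g 1 := by
  obtain rfl : g = ⟨wtG s β Γ (n + m), h.wtG_mem _⟩ := Subtype.ext hg
  rw [monomialAction, Finsupp.linearCombination_single, one_smul]

theorem monomialAction_zero (h : IsPrebrick s β Γ) {ev : V3 → ℂ} (hev0 : ev 0 = 1) :
    monomialAction h ev 0 = 1 := by
  refine Finsupp.lhom_ext' fun m => LinearMap.ext_ring ?_
  have hm : wtG s β Γ (0 + (m : V3)) = m := by rw [zero_add, h.wtG_eq_of_mem m.2]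
  simp [monomialAction_single h ev 0 m m hm.symm, h.wtG_eq_of_mem m.2, hev0]

theorem monomialAction_add (h : IsPrebrick s β Γ) {ev : V3 → ℂ}
    (hevmul : ∀ u v : V3, u ∈ SG s β Γ → v ∈ SG s β Γ → ev (u + v) = ev u * ev v)
    {a b : V3} (ha : IsNat3 a) (hb : IsNat3 b) :
    monomialAction h ev (a + b) = monomialAction h ev a * monomialAction h ev b := by
  refine Finsupp.lhom_ext' fun m => LinearMap.ext_ring ?_
  have hwt : wtG s β Γ (a + wtG s β Γ (b + m)) = wtG s β Γ (a + b + m) := by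
    rw [h.wtG_add_wtG_s2, add_assoc]
  let g : ↥Γ := ⟨wtG s β Γ (b + m), h.wtG_mem _⟩
  let k : ↥Γ := ⟨wtG s β Γ (a + b + m), h.wtG_mem _⟩
  have hsum : a + b + (m : V3) - wtG s β Γ (a + b + m) =
      (b + m - wtG s β Γ (b + m)) + (a + g - wtG s β Γ (a + g)) := by
    rw [show wtG s β Γ (a + g) = wtG s β Γ (a + b + m) from hwt]
    simp only [g]
    abel
  simp only [LinearMap.comp_apply, Finsupp.lsingle_apply, Module.End.mul_apply]
  rw [monomialAction_single h ev (a + b) m k rfl, monomialAction_single h ev b m g rfl,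
    map_smul, monomialAction_single h ev a g k hwt.symm, smul_smul, hsum,
    hevmul _ _ (sub_wtG_mem_SG hb m.2) (sub_wtG_mem_SG ha g.2)]

/-- The algebra homomorphism by which polynomials act on the free vector space on `Γ`. -/
def polynomialAction (h : IsPrebrick s β Γ) (ev : V3 → ℂ) (hev0 : ev 0 = 1)
    (hevmul : ∀ u v : V3, u ∈ SG s β Γ → v ∈ SG s β Γ → ev (u + v) = ev u * ev v) :
    MvPolynomial (Fin 3) ℂ →ₐ[ℂ] Module.End ℂ (↥Γ →₀ ℂ) :=
  AddMonoidAlgebra.lift ℂ (Module.End ℂ (↥Γ →₀ ℂ)) (Fin 3 →₀ ℕ)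
    { toFun := fun a => monomialAction h ev (natExponent a.toAdd)
      map_one' := by
        rw [toAdd_one, natExponent_zero, monomialAction_zero h hev0]
      map_mul' := fun a b => by
        rw [toAdd_mul, natExponent_add, monomialAction_add h hevmul
          (isNat3_natExponent _) (isNat3_natExponent _)] }

theorem polynomialAction_X (h : IsPrebrick s β Γ) (ev : V3 → ℂ) (hev0 : ev 0 = 1)
    (hevmul : ∀ u v : V3, u ∈ SG s β Γ → v ∈ SG s β Γ → ev (u + v) = ev u * ev v)
    (i : Fin 3) :
    polynomialAction h ev hev0 hevmul (MvPolynomial.X i) = monomialAction h ev (ee i) := by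
  refine (AddMonoidAlgebra.lift_single _ _ _).trans ?_
  rw [one_smul, ← natExponent_single]
  rfl

end Prebrick

/-- Lemma 2.13 (i),(ii) of the paper: given a prebrick `Γ` and a
monoid homomorphism `ev : S(Γ) → (ℂ, ×)` (the evaluation map of a point
`p ∈ U(Γ) = Spec ℂ[S(Γ)]`), the free ℂ-vector space with basis `Γ` carries a unique
`ℂ[x₁,x₂,x₃]`-module structure (encoded as an ℂ-algebra homomorphism into its
ℂ-endomorphism algebra) with
`x_i · m = ev(e_i + m − wt_Γ(e_i + m)) · wt_Γ(e_i + m)` for all `i` and `m ∈ Γ`.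
This module is the `G`-constellation `C(Γ)_p`, with ℂ-basis `Γ`. -/
theorem constellation_module_structure (r : ℕ) (hr : 0 < r) (β : Fin 3 → ℤ)
    (Γ : Set V3) (h : IsPrebrick r β Γ)
    (ev : V3 → ℂ) (hev0 : ev 0 = 1)
    (hevmul : ∀ s t : V3, s ∈ SG r β Γ → t ∈ SG r β Γ → ev (s + t) = ev s * ev t) :
    ∃! α : MvPolynomial (Fin 3) ℂ →ₐ[ℂ] Module.End ℂ (↥Γ →₀ ℂ),
      ∀ (i : Fin 3) (m g : ↥Γ), (g : V3) = wtG r β Γ (ee i + (m : V3)) →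
        α (MvPolynomial.X i) (Finsupp.single m 1) =
          ev (ee i + (m : V3) - wtG r β Γ (ee i + (m : V3))) • Finsupp.single g 1 := by
  refine ⟨polynomialAction h ev hev0 hevmul, fun i m g hg => ?_, fun α hα => ?_⟩
  · rw [polynomialAction_X, monomialAction_single h ev (ee i) m g hg]
  · refine MvPolynomial.algHom_ext fun i => Finsupp.lhom_ext' fun m => LinearMap.ext_ring ?_
    have hg := h.wtG_mem (ee i + (m : V3))
    simp only [LinearMap.comp_apply, Finsupp.lsingle_apply]
    rw [polynomialAction_X, monomialAction_single h ev (ee i) m ⟨_, hg⟩ rfl,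
      hα i m ⟨_, hg⟩ rfl]
end
end

section
/- Whenever m, m′ ∈ ℤ³ satisfy w(m) = w(m′) in ℤ/rℤ, one has w₂′(φ₂(m)) = w₂′(φ₂(m′)) in ℤ/aℤ and w₃′(φ₃(m)) = w₃′(φ₃(m′)) in ℤ/(r−a)ℤ; hence there are well-defined maps φ̄₂ : ℤ/rℤ → ℤ/aℤ and φ̄₃ : ℤ/rℤ → ℤ/(r−a)ℤ sending w(m) to w₂′(φ₂(m)) and to w₃′(φ₃(m)) respectively, and both maps are surjective. -/
noncomputable section

open Classical

/-- The weight of `m` for the type `(1/r)(1, a, r−a)` is the class of `d(m)`. -/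
theorem wmap_wtsG (r a : ℕ) (m : V3) : wmap r (wtsG r a) m = ((dd r a m : ℤ) : ZMod r) := by
  simp [wmap, wtsG, dd, Fin.sum_univ_three]

/-- The representative in `[0, r)` of the weight of `m` is `d(m) mod r`. -/
theorem val_wmap_wtsG (r a : ℕ) [NeZero r] (m : V3) :
    ((wmap r (wtsG r a) m).val : ℤ) = dd r a m - r * (dd r a m).fdiv r := by
  rw [wmap_wtsG, ZMod.val_intCast, Int.fdiv_eq_ediv_of_nonneg _ (Int.natCast_nonneg r),
    Int.emod_def]

/-- The weight of `φ₂(m)` is the reduction modulo `a` of the representative of `w(m)`. -/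
theorem wmap_phiRD_left (r a : ℕ) [NeZero r] (m : V3) :
    wmap a (gkWts r a 1) (phiRD r a 1 m) = ((wmap r (wtsG r a) m).val : ZMod a) := by
  rw [← Int.cast_natCast (R := ZMod a) (ZMod.val _), val_wmap_wtsG, wmap,
    ZMod.intCast_eq_intCast_iff_dvd_sub]
  refine ⟨m 1 - m 2, ?_⟩
  simp [Fin.sum_univ_three, gkWts, phiRD]
  simp only [dd]
  ring

/-- The weight of `φ₃(m)` is the reduction modulo `r − a` of the representative of `w(m)`. -/
theorem wmap_phiRD_right (r a : ℕ) [NeZero r] (h : a ≤ r) (m : V3) :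
    wmap (r - a) (gkWts r a 2) (phiRD r a 2 m) =
      ((wmap r (wtsG r a) m).val : ZMod (r - a)) := by
  rw [← Int.cast_natCast (R := ZMod (r - a)) (ZMod.val _), val_wmap_wtsG, wmap,
    ZMod.intCast_eq_intCast_iff_dvd_sub]
  refine ⟨m 2 - m 1, ?_⟩
  simp [Fin.sum_univ_three, gkWts, phiRD, Nat.cast_sub h]
  simp only [dd]
  ring

/-- For `0 < s ≤ r`, reducing representatives in `[0, r)` modulo `s` is surjective. -/
theorem surjective_val_cast (r s : ℕ) (hs : 0 < s) (hsr : s ≤ r) :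
    Function.Surjective fun x : ZMod r => (x.val : ZMod s) := by
  intro y
  have : NeZero s := ⟨hs.ne'⟩
  refine ⟨(y.val : ZMod r), ?_⟩
  simp only
  rw [ZMod.val_cast_of_lt (y.val_lt.trans_le hsr), ZMod.natCast_zmod_val]

/-- Lemma 3.6, second part: the round down functions `φ₂, φ₃`
respect weights, hence induce well-defined surjective maps
`φ̄₂ : ℤ/rℤ → ℤ/aℤ` and `φ̄₃ : ℤ/rℤ → ℤ/(r−a)ℤ` on characters. -/
theorem phiRD_induces_surjective_on_weights (r a : ℕ) (h1 : 0 < a) (h2 : a < r)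
    (hcop : Nat.Coprime r a) :
    (∀ m m' : V3, wmap r (wtsG r a) m = wmap r (wtsG r a) m' →
        wmap a (gkWts r a 1) (phiRD r a 1 m) = wmap a (gkWts r a 1) (phiRD r a 1 m')) ∧
    (∀ m m' : V3, wmap r (wtsG r a) m = wmap r (wtsG r a) m' →
        wmap (r - a) (gkWts r a 2) (phiRD r a 2 m) =
          wmap (r - a) (gkWts r a 2) (phiRD r a 2 m')) ∧
    (∃ f : ZMod r → ZMod a, Function.Surjective f ∧
        ∀ m : V3, f (wmap r (wtsG r a) m) = wmap a (gkWts r a 1) (phiRD r a 1 m)) ∧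
    (∃ g : ZMod r → ZMod (r - a), Function.Surjective g ∧
        ∀ m : V3, g (wmap r (wtsG r a) m) = wmap (r - a) (gkWts r a 2) (phiRD r a 2 m)) := by
  have : NeZero r := ⟨by omega⟩
  refine ⟨fun m m' h => ?_, fun m m' h => ?_,
    ⟨_, surjective_val_cast r a h1 h2.le, fun m => (wmap_phiRD_left r a m).symm⟩,
    ⟨_, surjective_val_cast r (r - a) (by omega) (by omega),
      fun m => (wmap_phiRD_right r a h2.le m).symm⟩⟩
  · rw [wmap_phiRD_left, wmap_phiRD_left, h]
  · rw [wmap_phiRD_right r a h2.le, wmap_phiRD_right r a h2.le, h]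
end
end

section
/- For every k ∈ {1,2,3}, every K ∈ ℤ³ and every standard basis vector g ∈ {e₁, e₂, e₃}, there exist i ∈ {1,2,3} and m ∈ ℤ³ such that φ_k(m) = K and φ_k(m + e_i) = K + g. -/
noncomputable section

open Classical

theorem dd_add_ee (r a : ℕ) (m : V3) (i : Fin 3) :
    dd r a (m + ee i) = dd r a m + wtsG r a i := by
  fin_cases i <;> simp [dd, wtsG, ee] <;> ring

theorem dd_update (r a : ℕ) (m : V3) (k : Fin 3) (t : ℤ) :
    dd r a (Function.update m k t) = wtsG r a k * t + (dd r a m - wtsG r a k * m k) := by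
  fin_cases k <;> simp [dd, wtsG] <;> ring

theorem wtsG_pos {r a : ℕ} (h1 : 0 < a) (h2 : a < r) (k : Fin 3) : 0 < wtsG r a k := by
  fin_cases k <;> simp [wtsG] <;> omega

theorem wtsG_le {r a : ℕ} (h1 : 0 < a) (h2 : a < r) (k : Fin 3) : wtsG r a k ≤ r := by
  fin_cases k <;> simp [wtsG] <;> omega

theorem wtsG_add_le {r a : ℕ} (h1 : 0 < a) (h2 : a < r) {j k : Fin 3} (hjk : j ≠ k) :
    wtsG r a j + wtsG r a k ≤ r := by
  fin_cases j <;> fin_cases k <;> simp [wtsG] at hjk ⊢ <;> omega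

/-- An arithmetic progression with positive difference `α` meets every half-open interval
of length `α`. -/
theorem exists_mul_add_mem_Ico {α : ℤ} (hα : 0 < α) (c L : ℤ) :
    ∃ t : ℤ, L ≤ α * t + c ∧ α * t + c < L + α := by
  refine ⟨-((c - L) / α), ?_⟩
  have h := Int.emod_add_mul_ediv (c - L) α
  have h0 := Int.emod_nonneg (c - L) hα.ne'
  have h1 := Int.emod_lt_of_pos (c - L) hα
  constructor <;> linarith

theorem phiRD_eq_of_bounds {r a : ℕ} {k : Fin 3} {m K : V3} (hm : ∀ l, l ≠ k → m l = K l)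
    (hle : r * K k ≤ dd r a m) (hlt : dd r a m < r * K k + r) : phiRD r a k m = K := by
  have hr : (0 : ℤ) < r := by linarith
  have hdiv : (dd r a m).fdiv r = K k := by
    rw [Int.fdiv_eq_ediv_of_nonneg _ hr.le]
    apply le_antisymm
    · exact Int.lt_add_one_iff.mp ((Int.ediv_lt_iff_lt_mul hr).mpr (by linarith))
    · exact (Int.le_ediv_iff_mul_le hr).mpr (by linarith)
  funext l
  by_cases hl : l = k
  · subst hl
    simp [phiRD, hdiv]
  · simp [phiRD, hl, hm l hl]

/-- Lemma 3.8 of the paper: for every lattice point `K` in the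
monomial lattice `M_k` and every degree-one monomial `g = e_j`, there exist a
degree-one monomial `e_i` and `m ∈ ℤ³` with `φ_k(m) = K` and `φ_k(e_i·m) = g·K`. -/
theorem phiRD_lift_step (r a : ℕ) (h1 : 0 < a) (h2 : a < r) (hcop : Nat.Coprime r a)
    (k : Fin 3) (K : V3) (j : Fin 3) :
    ∃ (i : Fin 3) (m : V3), phiRD r a k m = K ∧ phiRD r a k (m + ee i) = K + ee j := by
  have hk := wtsG_pos h1 h2 k
  have hj := wtsG_pos h1 h2 j
  have hkr := wtsG_le h1 h2 k
  obtain ⟨t, hL, hU⟩ := exists_mul_add_mem_Ico hk (dd r a K - wtsG r a k * K k)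
    (if j = k then r * K k + r - wtsG r a k else r * K k)
  rw [← dd_update] at hL hU
  have hm : ∀ l, l ≠ k → Function.update K k t l = K l := fun l hl => by simp [hl]
  have hm' : ∀ l, l ≠ k → (Function.update K k t + ee j) l = (K + ee j) l :=
    fun l hl => by simp [hl]
  refine ⟨j, Function.update K k t, ?_⟩
  by_cases hjk : j = k
  · subst hjk
    rw [if_pos rfl] at hL hU
    have hK : (K + ee j) j = K j + 1 := by simp [ee]
    refine ⟨phiRD_eq_of_bounds hm ?_ ?_, phiRD_eq_of_bounds hm' ?_ ?_⟩ <;>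
      (try simp only [dd_add_ee, hK]) <;> linarith
  · rw [if_neg hjk] at hL hU
    have hsum := wtsG_add_le h1 h2 hjk
    have hK : (K + ee j) k = K k := by simp [ee, Ne.symm hjk]
    refine ⟨phiRD_eq_of_bounds hm ?_ ?_, phiRD_eq_of_bounds hm' ?_ ?_⟩ <;>
      (try simp only [dd_add_ee, hK]) <;> linarith
end
end

section
/- For k ∈ {1,2,3}, let Γ′ be a G_k-prebrick, let Γ := φ_k⁻¹(Γ′), and let m ∈ Γ with j ∈ {0,…,r−1} the residue of d(m) modulo r. Then: (i) if k = 2 and j < r−a then m + e₂ ∈ Γ; (ii) if k = 3 and j < a then m + e₃ ∈ Γ; (iii) if k = 1 and j < r−1 then m + e₁ ∈ Γ. -/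
noncomputable section

open Classical

theorem dd_add (r a : ℕ) (m n : V3) : dd r a (m + n) = dd r a m + dd r a n := by
  simp only [dd, Pi.add_apply]
  ring

/-- `φ_k` does not change under adding `e_k` as long as the residue of `d` does not overflow. -/
theorem phiRD_add_ee {r a : ℕ} {k : Fin 3} {m : V3} (hpos : 0 ≤ dd r a (ee k))
    (hlt : dd r a m % (r : ℤ) + dd r a (ee k) < r) :
    phiRD r a k (m + ee k) = phiRD r a k m := by
  have hr : (0 : ℤ) ≤ r := Int.natCast_nonneg r
  have hdiv : (dd r a m + dd r a (ee k)) / (r : ℤ) = dd r a m / (r : ℤ) := by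
    rcases hr.eq_or_lt with hr0 | hr0
    · simp [← hr0]
    · have hnonneg := Int.emod_nonneg (dd r a m) hr0.ne'
      have hsplit := Int.mul_ediv_add_emod (dd r a m) r
      refine Int.ediv_eq_iff_of_pos hr0 |>.2 ⟨?_, ?_⟩ <;> linarith
  funext i
  rcases eq_or_ne i k with rfl | hik
  · simp only [phiRD, Function.update_self, dd_add, Int.fdiv_eq_ediv_of_nonneg _ hr, hdiv]
  · simp [phiRD, ee, hik]

/-- Lemma 4.6 of the paper: for `Γ = φ_k⁻¹(Γ′)`, `m ∈ Γ` with
residue `j` of `d(m)` mod `r`: (i) if `k = 2` and `j < r−a` then `y·m ∈ Γ`;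
(ii) if `k = 3` and `j < a` then `z·m ∈ Γ`; (iii) if `k = 1` and `j < r−1`
then `x·m ∈ Γ`. (Indices `0,1,2` correspond to `k = 1,2,3`.) -/
theorem step_mem_preimage (r a : ℕ) (h1 : 0 < a) (h2 : a < r) (hcop : Nat.Coprime r a)
    (k : Fin 3) (Γ' : Set V3) (h' : IsPrebrick (gkMod r a k) (gkWts r a k) Γ')
    (m : V3) (hm : m ∈ phiRD r a k ⁻¹' Γ') (j : ℤ) (hj : j = dd r a m % (r : ℤ)) :
    (k = 1 → j < (r : ℤ) - (a : ℤ) → m + ee 1 ∈ phiRD r a k ⁻¹' Γ') ∧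
    (k = 2 → j < (a : ℤ) → m + ee 2 ∈ phiRD r a k ⁻¹' Γ') ∧
    (k = 0 → j < (r : ℤ) - 1 → m + ee 0 ∈ phiRD r a k ⁻¹' Γ') := by
  subst hj
  refine ⟨?_, ?_, ?_⟩ <;> rintro rfl hlt <;>
    rw [Set.mem_preimage, phiRD_add_ee] <;>
    first
    | exact hm
    | (simp [dd, ee] at hlt ⊢ <;> omega)
end
end

section
/- Let Γ′ be a G₂-prebrick and Γ := φ₂⁻¹(Γ′). Suppose A ⊆ Γ satisfies (a) for every m ∈ A and every i ∈ {1,2,3}, if e_i + m ∈ Γ then e_i + m ∈ A, and (b) A = Γ ∩ φ₂⁻¹(φ₂(A)). Then B := φ₂(A) ⊆ Γ′ satisfies the analogous closure property in Γ′: for every k ∈ B and every i ∈ {1,2,3}, if e_i + k ∈ Γ′ then e_i + k ∈ B. -/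
noncomputable section

open Classical

lemma phiRD_one_eq_iff {r : ℕ} (hr : 0 < r) (a : ℕ) (m K : V3) :
    phiRD r a 1 m = K ↔ m 0 = K 0 ∧ m 2 = K 2 ∧
      (r : ℤ) * K 1 ≤ dd r a m ∧ dd r a m < (r : ℤ) * K 1 + r := by
  have hr' : (0 : ℤ) < r := by exact_mod_cast hr
  have hdiv : (dd r a m).fdiv r = K 1 ↔
      (r : ℤ) * K 1 ≤ dd r a m ∧ dd r a m < (r : ℤ) * K 1 + r := by
    rw [Int.fdiv_eq_ediv_of_nonneg _ hr'.le, Int.ediv_eq_iff_of_pos hr', mul_comm]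
  simp only [phiRD, funext_iff, Fin.forall_fin_succ, ← hdiv]
  simp [Function.update]
  tauto

/-- Varying only the second coordinate, `d` takes a value in every half-open interval of
length `a`. -/
lemma exists_dd_mem_Ico {a : ℕ} (ha : 0 < a) (r : ℕ) (K : V3) (l : ℤ) :
    ∃ m : V3, m 0 = K 0 ∧ m 2 = K 2 ∧ l ≤ dd r a m ∧ dd r a m < l + a := by
  have ha' : (0 : ℤ) < a := by exact_mod_cast ha
  set x : ℤ := K 0 + ((r : ℤ) - a) * K 2 - l with hx
  refine ⟨![K 0, -(x / a), K 2], rfl, rfl, ?_⟩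
  have hdd : dd r a ![K 0, -(x / a), K 2] = l + x % a := by
    have := Int.emod_add_mul_ediv x a
    simp only [dd, Matrix.cons_val]
    linarith
  rw [hdd]
  have := Int.emod_nonneg x ha'.ne'
  have := Int.emod_lt_of_pos x ha'
  constructor <;> linarith

lemma dd_ee_add (r a : ℕ) (i : Fin 3) (m : V3) :
    dd r a (ee i + m) = wtsG r a i + dd r a m := by
  fin_cases i <;> simp [dd, ee, wtsG] <;> ring

/-- Every multiplication step in `ℤ³` lifts along the left round down function. -/
lemma exists_phiRD_one_ee_add {r a : ℕ} (h1 : 0 < a) (h2 : a < r) (K : V3) (i : Fin 3) :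
    ∃ m : V3, phiRD r a 1 m = K ∧ phiRD r a 1 (ee i + m) = ee i + K := by
  have h1' : (0 : ℤ) < a := by exact_mod_cast h1
  have h2' : (a : ℤ) < r := by exact_mod_cast h2
  have hr : 0 < r := h1.trans h2
  obtain ⟨m, hm0, hm2, hl, hu⟩ :=
    exists_dd_mem_Ico h1 r K (r * K 1 + if i = 1 then (r : ℤ) - a else 0)
  refine ⟨m, ?_⟩
  simp only [phiRD_one_eq_iff hr, dd_ee_add, Pi.add_apply, hm0, hm2, true_and]
  fin_cases i <;> simp [ee, wtsG, mul_add] at hl hu ⊢ <;>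
    refine ⟨⟨?_, ?_⟩, ?_, ?_⟩ <;> linarith

/-- part of the proof of Lemma 4.11: if `A ⊆ Γ = φ₂⁻¹(Γ′)` is
closed under multiplication by `x, y, z` inside `Γ` and `A = Γ ∩ φ₂⁻¹(φ₂(A))`,
then `φ₂(A)` is closed under multiplication by the eigencoordinates inside `Γ′`. -/
theorem image_submodule_closed (r a : ℕ) (h1 : 0 < a) (h2 : a < r) (hcop : Nat.Coprime r a)
    (Γ' : Set V3) (h' : IsPrebrick (gkMod r a 1) (gkWts r a 1) Γ')
    (A : Set V3) (hA : A ⊆ phiRD r a 1 ⁻¹' Γ')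
    (ha : ∀ m ∈ A, ∀ i : Fin 3, ee i + m ∈ phiRD r a 1 ⁻¹' Γ' → ee i + m ∈ A)
    (hb : A = (phiRD r a 1 ⁻¹' Γ') ∩ (phiRD r a 1 ⁻¹' (phiRD r a 1 '' A))) :
    ∀ K ∈ phiRD r a 1 '' A, ∀ i : Fin 3, ee i + K ∈ Γ' → ee i + K ∈ phiRD r a 1 '' A := by
  rintro K ⟨m₀, hm₀, hK⟩ i hi
  obtain ⟨m, hm, hstep⟩ := exists_phiRD_one_ee_add h1 h2 K i
  have hmA : m ∈ A := by
    rw [hb]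
    exact ⟨by simpa [hm, hK] using hA hm₀, m₀, hm₀, hK.trans hm.symm⟩
  exact ⟨ee i + m, ha m hmA i (by simpa [hstep] using hi), hstep⟩
end
end

section
/- Let Γ′ be a G₂-prebrick, Γ := φ₂⁻¹(Γ′), and let A ⊆ Γ satisfy the closure property: for every m ∈ A and every i ∈ {1,2,3}, if e_i + m ∈ Γ then e_i + m ∈ A. If m ∈ A and the residue of d(m) modulo r is strictly less than a, then every m′ ∈ ℤ³ with φ₂(m′) = φ₂(m) lies in A. -/
noncomputable section

open Classical

/-- Adding `k` copies of `e₂` to `m` raises `d(m)` by `a * k`. -/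
theorem dd_smul_ee_one_add (r a : ℕ) (k : ℤ) (m : V3) :
    dd r a (k • ee 1 + m) = dd r a m + a * k := by
  simp [dd, ee]
  ring

/-- Translating `m` by a multiple of `e₂` preserves `φ₂(m)` exactly when it preserves
`⌊d(m)/r⌋`. -/
theorem phiRD_smul_ee_one_add_eq_iff (r a : ℕ) (k : ℤ) (m : V3) :
    phiRD r a 1 (k • ee 1 + m) = phiRD r a 1 m ↔
      (dd r a m + a * k) / (r : ℤ) = dd r a m / (r : ℤ) := by
  have hr : (0 : ℤ) ≤ r := Int.natCast_nonneg r
  simp only [phiRD, dd_smul_ee_one_add, Int.fdiv_eq_ediv_of_nonneg _ hr]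
  constructor
  · intro h
    simpa using congrFun h 1
  · intro h
    funext i
    fin_cases i <;> simp [ee, h]

/-- Two points with the same image under `φ₂` differ by a multiple of `e₂`. -/
theorem exists_smul_ee_one_add_of_phiRD_eq (r a : ℕ) {m m' : V3}
    (h : phiRD r a 1 m' = phiRD r a 1 m) : ∃ k : ℤ, m' = k • ee 1 + m := by
  refine ⟨m' 1 - m 1, ?_⟩
  have h0 := congrFun h 0
  have h2 := congrFun h 2
  simp [phiRD] at h0 h2
  funext i
  fin_cases i <;> simp [ee, h0, h2]

/-- part of the proof of Lemma 4.11: if `A ⊆ Γ = φ₂⁻¹(Γ′)` is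
closed under multiplication by `x, y, z` inside `Γ`, `m ∈ A` and the residue of
`d(m)` mod `r` is `< a`, then the whole fiber `φ₂⁻¹(φ₂(m))` is contained in `A`. -/
theorem fiber_subset_of_small_residue (r a : ℕ) (h1 : 0 < a) (h2 : a < r)
    (hcop : Nat.Coprime r a)
    (Γ' : Set V3) (h' : IsPrebrick (gkMod r a 1) (gkWts r a 1) Γ')
    (A : Set V3) (hA : A ⊆ phiRD r a 1 ⁻¹' Γ')
    (hcl : ∀ m ∈ A, ∀ i : Fin 3, ee i + m ∈ phiRD r a 1 ⁻¹' Γ' → ee i + m ∈ A)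
    (m : V3) (hm : m ∈ A) (hres : dd r a m % (r : ℤ) < (a : ℤ))
    (m' : V3) (hm' : phiRD r a 1 m' = phiRD r a 1 m) :
    m' ∈ A := by
  have hr : (0 : ℤ) < r := by omega
  have ha : (0 : ℤ) < a := by omega
  have ascend : ∀ k : ℕ, phiRD r a 1 ((k : ℤ) • ee 1 + m) = phiRD r a 1 m →
      (k : ℤ) • ee 1 + m ∈ A := by
    intro k
    induction k with
    | zero => intro _; simpa using hm
    | succ k ih =>
      intro h
      have hprev : phiRD r a 1 ((k : ℤ) • ee 1 + m) = phiRD r a 1 m := by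
        rw [phiRD_smul_ee_one_add_eq_iff] at h ⊢
        apply le_antisymm
        · rw [← h]
          apply Int.ediv_le_ediv hr
          push_cast
          linarith
        · apply Int.ediv_le_ediv hr
          have : (0 : ℤ) ≤ a * k := by positivity
          linarith
      have hsplit : ((k + 1 : ℕ) : ℤ) • ee 1 + m = ee 1 + ((k : ℤ) • ee 1 + m) := by
        push_cast
        rw [add_smul, one_smul]
        abel
      have hmem : ((k + 1 : ℕ) : ℤ) • ee 1 + m ∈ phiRD r a 1 ⁻¹' Γ' := by
        rw [Set.mem_preimage, h]
        exact hA hm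
      rw [hsplit] at hmem ⊢
      exact hcl _ (ih hprev) 1 hmem
  obtain ⟨k, rfl⟩ := exists_smul_ee_one_add_of_phiRD_eq r a hm'
  have hk : 0 ≤ k := by
    by_contra! hneg
    have hfloor := (phiRD_smul_ee_one_add_eq_iff r a k m).mp hm'
    have hlow := Int.mul_ediv_self_le (x := dd r a m + a * k) hr.ne'
    rw [hfloor] at hlow
    have hdiv := Int.emod_add_mul_ediv (dd r a m) r
    nlinarith
  lift k to ℕ using hk
  exact ascend k hm'
end
end

section
/- Let r ≥ 2 and let G be the cyclic group of type (1/r)(1, r−1, 1). For each of the 2r−1 G-bricks Γ_j defined by Γ_i := { j·e₂ : 0 ≤ j ≤ i−1 } ∪ { j·e₃ : 1 ≤ j ≤ r−i } for 1 ≤ i ≤ r and Γ_{r+i} := { j·e₂ : 0 ≤ j ≤ i−1 } ∪ { j·e₁ : 1 ≤ j ≤ r−i } for 1 ≤ i ≤ r−1, the ℂ-algebra ℂ[D(Γ_j)], formed with respect to the modulus r and weights (1, r−1, 1), is isomorphic to a polynomial ring in three variables over ℂ (i.e. U(Γ_j) = D(Γ_j) ≅ ℂ³). -/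
noncomputable section

open Classical

/-- `eltOf s β Γ ρ` is the unique element `m_ρ` of `Γ` of weight `ρ`
(when `Γ` is a prebrick). -/
noncomputable def eltOf (s : ℕ) (β : Fin 3 → ℤ) (Γ : Set V3) (ρ : ZMod s) : V3 :=
  Classical.epsilon fun g => g ∈ Γ ∧ wmap s β g = ρ

/-- The ideal `I_Γ` of the deformation space `D(Γ)`: generated by the commutation
relations `X_{i,ρ}X_{j,ρ+β_i} − X_{j,ρ}X_{i,ρ+β_j}` together with `X_{i,ρ} − 1`
for every pair `(i, ρ)` with `e_i + m_ρ ∈ Γ`. -/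
noncomputable def defIdeal (s : ℕ) (β : Fin 3 → ℤ) (Γ : Set V3) :
    Ideal (MvPolynomial (Fin 3 × ZMod s) ℂ) :=
  Ideal.span
    ({p | ∃ (i j : Fin 3) (ρ : ZMod s),
        p = MvPolynomial.X (i, ρ) * MvPolynomial.X (j, ρ + ((β i : ℤ) : ZMod s)) -
            MvPolynomial.X (j, ρ) * MvPolynomial.X (i, ρ + ((β j : ℤ) : ZMod s))} ∪
      {p | ∃ (i : Fin 3) (ρ : ZMod s),
        ee i + eltOf s β Γ ρ ∈ Γ ∧ p = MvPolynomial.X (i, ρ) - 1})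

/-- The coordinate ring `ℂ[D(Γ)]` of the deformation space of `C(Γ)`. -/
abbrev DRing (s : ℕ) (β : Fin 3 → ℤ) (Γ : Set V3) : Type :=
  MvPolynomial (Fin 3 × ZMod s) ℂ ⧸ defIdeal s β Γ

/-- `Γ_i = {1, y, …, y^{i−1}, z, …, z^{r−i}}` for `1 ≤ i ≤ r`. -/
def GammaYZ (r i : ℕ) : Set V3 :=
  {m | ∃ j : ℕ, j < i ∧ m = (j : ℤ) • ee 1} ∪
    {m | ∃ j : ℕ, 1 ≤ j ∧ j ≤ r - i ∧ m = (j : ℤ) • ee 2}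

/-- `Γ_{r+i} = {1, y, …, y^{i−1}, x, …, x^{r−i}}` for `1 ≤ i ≤ r−1`. -/
def GammaYX (r i : ℕ) : Set V3 :=
  {m | ∃ j : ℕ, j < i ∧ m = (j : ℤ) • ee 1} ∪
    {m | ∃ j : ℕ, 1 ≤ j ∧ j ≤ r - i ∧ m = (j : ℤ) • ee 0}

/-- Coordinates of the elements of `Γ_i` (`u = 2`) and `Γ_{r+i}` (`u = 0`), with `p = i - 1`. -/
theorem mem_gamma_iff (r p : ℕ) (hp : p < r) (u : Fin 3) (hu : u ≠ 1) (m : V3) :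
    m ∈ ({m | ∃ j : ℕ, j < p + 1 ∧ m = (j : ℤ) • ee 1} ∪
      {m | ∃ j : ℕ, 1 ≤ j ∧ j ≤ r - (p + 1) ∧ m = (j : ℤ) • ee u} : Set V3) ↔
    (∀ k, k ≠ 1 → k ≠ u → m k = 0) ∧ ((m u = 0 ∧ 0 ≤ m 1 ∧ m 1 ≤ p) ∨
      (m 1 = 0 ∧ 1 ≤ m u ∧ m u + p + 1 ≤ r)) := by
  constructor
  · rintro (⟨j, hj, rfl⟩ | ⟨j, hj, hj', rfl⟩)
    · refine ⟨fun k h1 h2 => by simp [ee, h1], Or.inl ?_⟩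
      simp [ee, hu]
      omega
    · refine ⟨fun k h1 h2 => by simp [ee, h2], Or.inr ?_⟩
      simp [ee, hu.symm]
      omega
  · rintro ⟨h, ⟨h1, h2, h3⟩ | ⟨h1, h2, h3⟩⟩
    · refine Or.inl ⟨(m 1).toNat, by omega, funext fun k => ?_⟩
      by_cases hk : k = 1
      · subst hk; simp [ee, h2]
      · by_cases hk' : k = u
        · subst hk'; simp [ee, hk, h1]
        · simp [ee, hk, h k hk hk']
    · refine Or.inr ⟨(m u).toNat, by omega, by omega, funext fun k => ?_⟩
      by_cases hk : k = u
      · subst hk; simp [ee]; omega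
      · by_cases hk' : k = 1
        · subst hk'; simp [ee, hk, h1]
        · simp [ee, hk, h k hk' hk]

theorem wmap_one_neg_one_one (r : ℕ) (m : V3) :
    wmap r ![1, (r : ℤ) - 1, 1] m = ((m 0 - m 1 + m 2 : ℤ) : ZMod r) := by
  simp [wmap, Fin.sum_univ_three, sub_eq_add_neg]

theorem val_add_one_eq_ite {r : ℕ} [NeZero r] (x : ZMod r) :
    (x + 1).val = if x.val + 1 = r then 0 else x.val + 1 := by
  have hx := x.val_lt
  have h : x + 1 = ((x.val + 1 : ℕ) : ZMod r) := by simp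
  rw [h, ZMod.val_natCast]
  split_ifs with h'
  · rw [h', Nat.mod_self]
  · exact Nat.mod_eq_of_lt (by omega)

theorem val_sub_one_eq_ite {r : ℕ} [NeZero r] (x : ZMod r) :
    (x - 1).val = if x.val = 0 then r - 1 else x.val - 1 := by
  have h := val_add_one_eq_ite (x - 1)
  have h1 := (x - 1).val_lt
  rw [sub_add_cancel] at h
  split_ifs at h ⊢ <;> omega

/-- The unit arrows of the quiver representation attached to `Γ`, in terms of the position
`(ρ + p).val` of `ρ` along the chain `Γ`. -/
theorem ee_add_eltOf_mem_iff (r p : ℕ) [NeZero r] (hp : p < r) (u : Fin 3) (hu : u ≠ 1)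
    (Γ : Set V3)
    (hΓ : Γ = {m | ∃ j : ℕ, j < p + 1 ∧ m = (j : ℤ) • ee 1} ∪
      {m | ∃ j : ℕ, 1 ≤ j ∧ j ≤ r - (p + 1) ∧ m = (j : ℤ) • ee u})
    (k : Fin 3) (ρ : ZMod r) :
    ee k + eltOf r ![1, (r : ℤ) - 1, 1] Γ ρ ∈ Γ ↔
      (k = 1 ∧ 0 < (ρ + p).val ∧ (ρ + p).val ≤ p) ∨
      (k = u ∧ p ≤ (ρ + p).val ∧ (ρ + p).val + 1 < r) := by
  have hmem := fun m => (Set.ext_iff.1 hΓ m).trans (mem_gamma_iff r p hp u hu m)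
  have hw : ∀ m ∈ Γ, wmap r ![1, (r : ℤ) - 1, 1] m = ((m u - m 1 : ℤ) : ZMod r) := by
    intro m hm
    have h0 := ((hmem m).1 hm).1
    rw [wmap_one_neg_one_one]
    fin_cases u
    · have := h0 2 (by decide) (by decide)
      simp [this]
    · exact absurd rfl hu
    · have := h0 0 (by decide) (by decide)
      simp [this, neg_add_eq_sub]
  set n := (ρ + p).val with hn
  have hnlt : n < r := ZMod.val_lt _
  have hρ : ρ = ((n : ℤ) - p : ℤ) := by simp [hn]
  have hex : ∃ g, g ∈ Γ ∧ wmap r ![1, (r : ℤ) - 1, 1] g = ρ := by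
    have hg : ∀ g, g ∈ Γ → g u - g 1 = n - p →
        ∃ g, g ∈ Γ ∧ wmap r ![1, (r : ℤ) - 1, 1] g = ρ :=
      fun g hg h => ⟨g, hg, by rw [hw g hg, h, hρ]⟩
    rcases le_or_gt n p with h | h
    · refine hg (((p - n : ℕ) : ℤ) • ee 1) ?_ ?_
      · rw [hΓ]; exact Or.inl ⟨p - n, by omega, rfl⟩
      · simp [ee, hu]; omega
    · refine hg (((n - p : ℕ) : ℤ) • ee u) ?_ ?_
      · rw [hΓ]; exact Or.inr ⟨n - p, by omega, by omega, rfl⟩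
      · simp [ee, hu.symm]; omega
  obtain ⟨hg, hgw⟩ := Classical.epsilon_spec hex
  change eltOf r ![1, (r : ℤ) - 1, 1] Γ ρ ∈ Γ at hg
  change wmap r _ (eltOf r ![1, (r : ℤ) - 1, 1] Γ ρ) = ρ at hgw
  generalize eltOf r ![1, (r : ℤ) - 1, 1] Γ ρ = g at hg hgw ⊢
  rw [hw g hg, hρ, ZMod.intCast_eq_intCast_iff] at hgw
  rw [hmem] at hg
  obtain ⟨h0, hg⟩ := hg
  have hgn : g u - g 1 = n - p := by
    have h1 : (g u - g 1 + p) ≡ n [ZMOD r] := by simpa using hgw.add_right (p : ℤ)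
    have h2 : g u - g 1 + p = n := by
      rw [Int.ModEq, Int.emod_eq_of_lt (by omega) (by omega),
        Int.emod_eq_of_lt (by omega) (by omega)] at h1
      exact h1
    omega
  rw [hmem]
  by_cases hk1 : k = 1
  · subst hk1
    have hz : ∀ k', k' ≠ 1 → k' ≠ u → (ee 1 + g) k' = 0 := fun k' h1 h2 => by
      simp [ee, h1, h0 k' h1 h2]
    have e1 : (ee 1 + g) 1 = 1 + g 1 := by simp [ee]
    have e2 : (ee 1 + g) u = g u := by simp [ee, hu]
    rw [e1, e2]
    simp only [hu.symm, false_and, or_false, true_and, and_iff_right hz]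
    omega
  · by_cases hku : k = u
    · subst hku
      have hz : ∀ k', k' ≠ 1 → k' ≠ k → (ee k + g) k' = 0 := fun k' h1 h2 => by
        simp [ee, h2, h0 k' h1 h2]
      have e1 : (ee k + g) 1 = g 1 := by simp [ee, hu.symm]
      have e2 : (ee k + g) k = 1 + g k := by simp [ee]
      rw [e1, e2]
      simp only [hk1, false_and, false_or, true_and, and_iff_right hz]
      omega
    · simp only [hk1, hku, false_and, or_false, iff_false]
      rintro ⟨h, -⟩
      have := h k hk1 hku
      simp [ee, h0 k hk1 hku] at this

/-- The value of the `k`-th arrow at position `n` of the chain in the universal family over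
affine three-space with coordinates `a, b, e`. -/
def edgeVal {R : Type*} [CommRing R] (r p : ℕ) (u : Fin 3) (a b e : R) (k : Fin 3) (n : ℕ) : R :=
  if k = 1 then (if n = 0 then b else if n ≤ p then 1 else a * b)
  else if k = u then (if n < p then a * b else if n + 1 < r then 1 else a)
  else if p + 1 = r then (if n < p then e * b else e)
  else (if n < p then e * (a * b) else if n + 1 < r then e else e * a)

theorem map_edgeVal {R S : Type*} [CommRing R] [CommRing S] [Algebra ℂ R] [Algebra ℂ S]
    (g : R →ₐ[ℂ] S) (r p : ℕ) (u : Fin 3) (a b e : R) (k : Fin 3) (n : ℕ) :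
    g (edgeVal r p u a b e k n) = edgeVal r p u (g a) (g b) (g e) k n := by
  simp only [edgeVal, apply_ite g, map_mul, map_one]

set_option maxHeartbeats 1000000 in
theorem edgeVal_mul_edgeVal_one {R : Type*} [CommRing R] (r p : ℕ) (hp : p < r)
    (u : Fin 3) (hu : u ≠ 1) (a b e : R) (k : Fin 3) (hk : k ≠ 1) (n : ℕ) (hn : n < r) :
    edgeVal r p u a b e k n * edgeVal r p u a b e 1 (if n + 1 = r then 0 else n + 1) =
      edgeVal r p u a b e 1 n * edgeVal r p u a b e k (if n = 0 then r - 1 else n - 1) := by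
  by_cases hpr : p + 1 = r <;> by_cases hku : k = u <;> by_cases h1 : n + 1 = r <;>
    by_cases h0 : n = 0 <;>
    simp only [edgeVal, hpr, hk, hku, h1, h0, hu, Nat.add_one_ne_zero, if_true, if_false] <;>
    split_ifs <;> first | contradiction | omega | ring1

theorem edgeVal_mul_edgeVal_of_ne {R : Type*} [CommRing R] (r p : ℕ) (hp : p < r)
    (u : Fin 3) (a b e : R) (k : Fin 3) (hk : k ≠ 1) (hu : u ≠ 1) (hku : k ≠ u) (n : ℕ)
    (hn : n < r) :
    edgeVal r p u a b e u n * edgeVal r p u a b e k (if n + 1 = r then 0 else n + 1) =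
      edgeVal r p u a b e k n * edgeVal r p u a b e u (if n + 1 = r then 0 else n + 1) := by
  by_cases hpr : p + 1 = r <;> by_cases h1 : n + 1 = r <;>
    simp only [edgeVal, hpr, hk, hku, h1, hu, if_true, if_false] <;>
    split_ifs <;> first | contradiction | omega | ring1

/-- The universal family satisfies the commutation relations. -/
theorem edgeVal_comm {R : Type*} [CommRing R] (r p : ℕ) [NeZero r] (hp : p < r)
    (u : Fin 3) (hu : u ≠ 1) (a b e : R) (i j : Fin 3) (x : ZMod r) :
    edgeVal r p u a b e i x.val *
        edgeVal r p u a b e j (x + ((![1, (r : ℤ) - 1, 1] i : ℤ) : ZMod r)).val =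
      edgeVal r p u a b e j x.val *
        edgeVal r p u a b e i (x + ((![1, (r : ℤ) - 1, 1] j : ℤ) : ZMod r)).val := by
  have hx := x.val_lt
  have h1 := val_add_one_eq_ite x
  have h2 := val_sub_one_eq_ite x
  have h3 : ∀ k : Fin 3, (((![1, (r : ℤ) - 1, 1] : Fin 3 → ℤ) k : ℤ) : ZMod r) =
      if k = 1 then -1 else 1 := by
    intro k; fin_cases k <;> simp
  rw [h3, h3]
  by_cases hi : i = 1 <;> by_cases hj : j = 1
  · subst hi hj; rfl
  · subst hi
    rw [if_pos rfl, if_neg hj, ← sub_eq_add_neg, h1, h2]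
    exact (edgeVal_mul_edgeVal_one r p hp u hu a b e j hj _ hx).symm
  · subst hj
    rw [if_pos rfl, if_neg hi, ← sub_eq_add_neg, h1, h2]
    exact edgeVal_mul_edgeVal_one r p hp u hu a b e i hi _ hx
  · rw [if_neg hi, if_neg hj]
    by_cases hiu : i = u <;> by_cases hju : j = u
    · rw [hiu, hju]
    · subst hiu
      rw [h1]
      exact edgeVal_mul_edgeVal_of_ne r p hp i a b e j hj hu hju _ hx
    · subst hju
      rw [h1]
      exact (edgeVal_mul_edgeVal_of_ne r p hp j a b e i hi hu hiu _ hx).symm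
    · simp only [edgeVal, hi, hj, hiu, hju, if_false]

/-- A family of arrows along the chain satisfying the commutation relations and the
normalisation by units is determined by three of its members. -/
theorem arrows_eq_edgeVal {R : Type*} [CommRing R] (r p : ℕ) (hp : p < r) (x y z : ℕ → R)
    (hxy : ∀ n, x (n + 1) * y (n + 2) = y (n + 1) * x n)
    (hzy : ∀ n, z (n + 1) * y (n + 2) = y (n + 1) * z n)
    (hxz : ∀ n, x n * z (n + 1) = z n * x (n + 1))
    (hper : y r = y 0) (hy1 : ∀ n, 0 < n → n ≤ p → y n = 1)
    (hz1 : ∀ n, p ≤ n → n + 1 < r → z n = 1) (n : ℕ) (hn : n < r) :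
    (y n = if n = 0 then y 0 else if n ≤ p then 1 else z (r - 1) * y 0) ∧
    (z n = if n < p then z (r - 1) * y 0 else if n + 1 < r then 1 else z (r - 1)) ∧
    (x n = if p + 1 = r then (if n < p then x p * y 0 else x p)
      else (if n < p then x p * (z (r - 1) * y 0) else if n + 1 < r then x p
        else x p * z (r - 1))) := by
  have const : ∀ w : ℕ → R, (∀ n, w (n + 1) * y (n + 2) = y (n + 1) * w n) →
      ∀ n, w n * y (n + 1) = w (r - 1) * y 0 := by
    intro w hw
    have h0 : ∀ n, w n * y (n + 1) = w 0 * y 1 := by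
      intro n
      induction n with
      | zero => rfl
      | succ n ih => rw [hw, mul_comm, ih]
    intro n
    have h := h0 (r - 1)
    rw [Nat.sub_add_cancel (by omega), hper] at h
    rw [h0, h]
  have hc := const z hzy
  have hd := const x hxy
  have hy : ∀ m, p ≤ m → m + 1 < r → y (m + 1) = z (r - 1) * y 0 := fun m h1 h2 => by
    rw [← hc m, hz1 m h1 h2, one_mul]
  have hconst : ∀ m, p + m + 1 < r → x (p + m) = x p := by
    intro m
    induction m with
    | zero => intro _; rfl
    | succ m ih =>
      intro h
      have := hxz (p + m)
      rw [hz1 _ (by omega) (by omega), hz1 (p + m) (by omega) (by omega), mul_one, one_mul] at this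
      rw [← ih (by omega), this, add_assoc]
  refine ⟨?_, ?_, ?_⟩
  · split_ifs with h1 h2
    · rw [h1]
    · exact hy1 n (by omega) h2
    · obtain ⟨m, rfl⟩ := Nat.exists_eq_succ_of_ne_zero h1
      exact hy m (by omega) (by omega)
  · split_ifs with h1 h2
    · rw [← hc n, hy1 (n + 1) (by omega) (by omega), mul_one]
    · exact hz1 n (by omega) h2
    · congr 1; omega
  · split_ifs with h1 h2 h3 h4
    · have := hd n
      rw [hy1 (n + 1) (by omega) (by omega), mul_one] at this
      rw [this]; congr 2; omega
    · congr 1; omega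
    · have := hd n
      rw [hy1 (n + 1) (by omega) (by omega), mul_one, ← hd p, hy p le_rfl (by omega)] at this
      exact this
    · have := hconst (n - p) (by omega)
      rwa [Nat.add_sub_cancel' (by omega)] at this
    · obtain ⟨m, rfl⟩ : ∃ m, n = p + m + 1 := ⟨n - p - 1, by omega⟩
      have := hxz (p + m)
      rw [hz1 (p + m) (by omega) (by omega), hconst m (by omega), one_mul] at this
      rw [← this]; congr 2; omega

/-- The deformation ring of a chain `y^p, …, y, 1, t, …, t^{r-1-p}`, where `t` is `x` or `z`,
is a polynomial ring in three variables. -/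
theorem nonempty_dRing_algEquiv (r p : ℕ) (hr : 2 ≤ r) (hp : p < r) (u v : Fin 3)
    (hu : u ≠ 1) (hv : v ≠ 1) (huv : u ≠ v) (Γ : Set V3)
    (hΓ : Γ = {m | ∃ j : ℕ, j < p + 1 ∧ m = (j : ℤ) • ee 1} ∪
      {m | ∃ j : ℕ, 1 ≤ j ∧ j ≤ r - (p + 1) ∧ m = (j : ℤ) • ee u}) :
    Nonempty (DRing r ![1, (r : ℤ) - 1, 1] Γ ≃ₐ[ℂ] MvPolynomial (Fin 3) ℂ) := by
  have : NeZero r := ⟨by omega⟩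
  set β : Fin 3 → ℤ := ![1, (r : ℤ) - 1, 1] with hβ
  have hβv : ∀ k : Fin 3, ((β k : ℤ) : ZMod r) = if k = 1 then -1 else 1 := by
    intro k; fin_cases k <;> simp [hβ]
  have hedge := ee_add_eltOf_mem_iff r p hp u hu Γ hΓ
  -- the map to the polynomial ring
  let f : Fin 3 × ZMod r → MvPolynomial (Fin 3) ℂ := fun s =>
    edgeVal r p u (MvPolynomial.X 0) (MvPolynomial.X 1) (MvPolynomial.X 2) s.1 (s.2 + p).val
  have hker : ∀ q ∈ defIdeal r β Γ, MvPolynomial.aeval (R := ℂ) f q = 0 := by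
    intro q hq
    rw [← RingHom.mem_ker]
    revert q
    refine Ideal.span_le.2 ?_
    rintro q (⟨i, j, ρ, rfl⟩ | ⟨i, ρ, h, rfl⟩)
    · have h := edgeVal_comm r p hp u hu (MvPolynomial.X 0 : MvPolynomial (Fin 3) ℂ)
        (MvPolynomial.X 1) (MvPolynomial.X 2) i j (ρ + p)
      simp only [SetLike.mem_coe, RingHom.mem_ker, map_sub, map_mul, MvPolynomial.aeval_X, f,
        sub_eq_zero]
      rwa [add_right_comm, add_right_comm ρ _ (p : ZMod r)]
    · rw [hedge] at h
      simp only [SetLike.mem_coe, RingHom.mem_ker, map_sub, map_one, MvPolynomial.aeval_X, f,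
        sub_eq_zero]
      rcases h with ⟨rfl, h1, h2⟩ | ⟨rfl, h1, h2⟩
      · simp [edgeVal, h2, h1.ne']
      · simp [edgeVal, hu, h1.not_gt, h2]
  let φ : DRing r β Γ →ₐ[ℂ] MvPolynomial (Fin 3) ℂ :=
    Ideal.Quotient.liftₐ (defIdeal r β Γ) (MvPolynomial.aeval f) hker
  -- the arrows in the quotient ring
  let c : Fin 3 → ℕ → DRing r β Γ := fun k n =>
    Ideal.Quotient.mk (defIdeal r β Γ) (MvPolynomial.X (k, (n : ZMod r) - p))
  have hcomm : ∀ (i j : Fin 3) (ρ : ZMod r),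
      Ideal.Quotient.mk (defIdeal r β Γ) (MvPolynomial.X (i, ρ)) *
        Ideal.Quotient.mk (defIdeal r β Γ) (MvPolynomial.X (j, ρ + ((β i : ℤ) : ZMod r))) =
      Ideal.Quotient.mk (defIdeal r β Γ) (MvPolynomial.X (j, ρ)) *
        Ideal.Quotient.mk (defIdeal r β Γ) (MvPolynomial.X (i, ρ + ((β j : ℤ) : ZMod r))) := by
    intro i j ρ
    rw [← map_mul, ← map_mul, Ideal.Quotient.eq]
    exact Ideal.subset_span (Or.inl ⟨i, j, ρ, rfl⟩)
  have hone : ∀ (k : Fin 3) (n : ℕ), n < r →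
      (k = 1 ∧ 0 < n ∧ n ≤ p) ∨ (k = u ∧ p ≤ n ∧ n + 1 < r) → c k n = 1 := by
    intro k n hn h
    change _ = Ideal.Quotient.mk (defIdeal r β Γ) 1
    rw [Ideal.Quotient.eq]
    refine Ideal.subset_span (Or.inr ⟨k, _, ?_, rfl⟩)
    rw [hedge, sub_add_cancel, ZMod.val_natCast, Nat.mod_eq_of_lt hn]
    exact h
  have hcy : ∀ k, k ≠ 1 → ∀ n, c k (n + 1) * c 1 (n + 2) = c 1 (n + 1) * c k n := by
    intro k hk n
    have h := hcomm k 1 (((n + 1 : ℕ) : ZMod r) - p)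
    rw [hβv, hβv, if_neg hk, if_pos rfl] at h
    convert h using 5 <;> push_cast <;> ring
  have hcc : ∀ n, c v n * c u (n + 1) = c u n * c v (n + 1) := by
    intro n
    have h := hcomm v u ((n : ZMod r) - p)
    rw [hβv, hβv, if_neg hu, if_neg hv] at h
    convert h using 5 <;> push_cast <;> ring
  have hval : ∀ k n, n < r → c k n = edgeVal r p u (c u (r - 1)) (c 1 0) (c v p) k n := by
    intro k n hn
    obtain ⟨h1, h2, h3⟩ := arrows_eq_edgeVal r p hp (c v) (c 1) (c u) (hcy v hv) (hcy u hu) hcc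
      (by simp [c]) (fun n h h' => hone 1 n (by omega) (Or.inl ⟨rfl, h, h'⟩))
      (fun n h h' => hone u n (by omega) (Or.inr ⟨rfl, h, h'⟩)) n hn
    have hk : k = 1 ∨ k = u ∨ k = v := by omega
    rcases hk with rfl | rfl | rfl
    · simpa only [edgeVal, if_true] using h1
    · simpa only [edgeVal, if_true, hu, if_false] using h2
    · simpa only [edgeVal, hv, huv.symm, if_false] using h3
  let ψ : MvPolynomial (Fin 3) ℂ →ₐ[ℂ] DRing r β Γ :=
    MvPolynomial.aeval ![c u (r - 1), c 1 0, c v p]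
  have hφc : ∀ k n, n < r → φ (c k n) = edgeVal r p u (MvPolynomial.X 0) (MvPolynomial.X 1)
      (MvPolynomial.X 2) k n := by
    intro k n hn
    have : φ (c k n) = f (k, (n : ZMod r) - p) := by
      change MvPolynomial.aeval f (MvPolynomial.X (k, (n : ZMod r) - p)) = _
      rw [MvPolynomial.aeval_X]
    rw [this]
    simp only [f, sub_add_cancel, ZMod.val_natCast, Nat.mod_eq_of_lt hn]
  refine ⟨AlgEquiv.ofAlgHom φ ψ ?_ ?_⟩
  · refine MvPolynomial.algHom_ext fun t => ?_
    change φ (ψ (MvPolynomial.X t)) = MvPolynomial.X t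
    simp only [ψ, MvPolynomial.aeval_X]
    fin_cases t
    · change φ (c u (r - 1)) = _
      rw [hφc _ _ (by omega)]
      simp only [edgeVal, hu, if_true, if_false]
      rw [if_neg (by omega), if_neg (by omega)]
      rfl
    · change φ (c 1 0) = _
      rw [hφc _ _ (by omega)]
      simp [edgeVal]
    · change φ (c v p) = _
      rw [hφc _ _ hp]
      simp only [edgeVal, hv, huv.symm, if_false, lt_irrefl]
      split_ifs <;> first | rfl | omega
  · refine Ideal.Quotient.algHom_ext _ (MvPolynomial.algHom_ext fun s => ?_)
    obtain ⟨k, ρ⟩ := s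
    change ψ (φ (Ideal.Quotient.mk _ (MvPolynomial.X (k, ρ)))) =
      Ideal.Quotient.mk _ (MvPolynomial.X (k, ρ))
    have hρ : Ideal.Quotient.mk (defIdeal r β Γ) (MvPolynomial.X (k, ρ)) = c k (ρ + p).val := by
      simp [c]
    have hlt := (ρ + (p : ZMod r)).val_lt
    rw [hρ, hφc _ _ hlt, map_edgeVal, hval _ _ hlt]
    simp [ψ]

/-- Section 4.1 of the paper: for the group of type
`(1/r)(1, r−1, 1)` and each of the `2r−1` `G`-bricks `Γ_j`, the deformation ring
`ℂ[D(Γ_j)]` is isomorphic as a ℂ-algebra to a polynomial ring in three variables,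
i.e. `U(Γ_j) = D(Γ_j) ≅ ℂ³`. -/
theorem dring_polynomial_for_a_eq_r_sub_one (r : ℕ) (hr : 2 ≤ r) :
    (∀ i : ℕ, 1 ≤ i → i ≤ r →
      Nonempty (DRing r ![1, (r : ℤ) - 1, 1] (GammaYZ r i) ≃ₐ[ℂ]
        MvPolynomial (Fin 3) ℂ)) ∧
    (∀ i : ℕ, 1 ≤ i → i ≤ r - 1 →
      Nonempty (DRing r ![1, (r : ℤ) - 1, 1] (GammaYX r i) ≃ₐ[ℂ]
        MvPolynomial (Fin 3) ℂ)) := by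
  refine ⟨fun i h1 h2 => ?_, fun i h1 h2 => ?_⟩
  · obtain ⟨p, rfl⟩ := Nat.exists_eq_add_of_le' h1
    exact nonempty_dRing_algEquiv r p hr (by omega) 2 0 (by decide) (by decide) (by decide) _ rfl
  · obtain ⟨p, rfl⟩ := Nat.exists_eq_add_of_le' h1
    exact nonempty_dRing_algEquiv r p hr (by omega) 0 2 (by decide) (by decide) (by decide) _ rfl
end
end
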